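/- arXiv:math/9910190 — 2 statements merged into one kernel-verified Lean document; each statement's English description precedes it below -/
import Mathlib

section
/- Let p be a prime number, A a commutative integral domain of characteristic p, I a proper ideal of A, and n ≥ 1 an integer. If a matrix γ ∈ SL_{n+1}(A) lies in the kernel of the reduction homomorphism SL_{n+1}(A) → SL_{n+1}(A/I) and γ has finite order, then the order of γ is a power of p. -/
/-- Over a domain, a matrix congruent to `1` modulo a proper ideal whose `m`-th power is `1`, with
`m` invertible, is the identity. -/
theorem Matrix.eq_one_of_pow_eq_one_of_map_eq_one {ι A : Type*} [Fintype ι] [DecidableEq ι]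
    [CommRing A] [IsDomain A] {I : Ideal A} (hI : I ≠ ⊤) {M : Matrix ι ι A} {m : ℕ}
    (hm : IsUnit (m : A)) (hpow : M ^ m = 1) (hmap : (Ideal.Quotient.mk I).mapMatrix M = 1) :
    M = 1 := by
  have : Nontrivial (A ⧸ I) := Ideal.Quotient.nontrivial_iff.mpr hI
  set S := ∑ i ∈ Finset.range m, M ^ i with hS
  have hmul : (M - 1) * S = 0 := by rw [hS, mul_geom_sum, hpow, sub_self]
  have hdet : S.det ≠ 0 := by
    intro h
    have hSmap : (Ideal.Quotient.mk I).mapMatrix S = (m : Matrix ι ι (A ⧸ I)) := by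
      simp [hS, map_sum, map_pow, hmap, -RingHom.mapMatrix_apply]
    have hunit : IsUnit (m : Matrix ι ι (A ⧸ I)) := by
      simpa using (hm.map (Ideal.Quotient.mk I)).map (algebraMap _ (Matrix ι ι (A ⧸ I)))
    rw [← hSmap, Matrix.isUnit_iff_isUnit_det, ← RingHom.map_det, h, map_zero] at hunit
    exact not_isUnit_zero hunit
  have hsmul : S.det • (M - 1) = 0 := by
    rw [← mul_one (M - 1), ← Matrix.mul_smul, ← Matrix.mul_adjugate, ← mul_assoc, hmul, zero_mul]
  exact sub_eq_zero.mp ((smul_eq_zero.mp hsmul).resolve_left hdet)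


/-- §2.4: torsion elements of a principal congruence subgroup `Γ(I) ⊆ SL_{n+1}(A)`,
for `A` an integral domain of characteristic `p` and `I` a proper ideal,
have order a power of `p`. -/
theorem stmt_0 (p : ℕ) (hp : p.Prime) (A : Type*) [CommRing A] [IsDomain A] [CharP A p]
    (I : Ideal A) (hI : I ≠ ⊤) (n : ℕ) (hn : 1 ≤ n)
    (γ : Matrix.SpecialLinearGroup (Fin (n + 1)) A)
    (hker : Matrix.SpecialLinearGroup.map (Ideal.Quotient.mk I) γ = 1)
    (hfin : IsOfFinOrder γ) :
    ∃ k : ℕ, orderOf γ = p ^ k := by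
  obtain ⟨k, m, hm, hord⟩ :=
    Nat.exists_eq_pow_mul_and_not_dvd hfin.orderOf_pos.ne' p hp.ne_one
  have hunit : IsUnit (m : A) :=
    (CharP.isUnit_natCast_iff hp).mpr hm
  have hpow : (γ ^ p ^ k) ^ m = 1 := by rw [← pow_mul, ← hord, pow_orderOf_eq_one]
  have hmap : Matrix.SpecialLinearGroup.map (Ideal.Quotient.mk I) (γ ^ p ^ k) = 1 := by
    rw [map_pow, hker, one_pow]
  have hone : γ ^ p ^ k = 1 := by
    apply Subtype.ext
    refine Matrix.eq_one_of_pow_eq_one_of_map_eq_one hI hunit ?_ ?_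
    · exact congrArg Subtype.val hpow
    · exact congrArg Subtype.val hmap
  obtain ⟨j, -, hj⟩ := (Nat.dvd_prime_pow hp).mp (orderOf_dvd_of_pow_eq_one hone)
  exact ⟨j, hj⟩
end

section
/- Let n ≥ 1 be an integer, q ≥ 2 a real number, l ≥ 1 an integer, and let c′, c be real numbers with 0 < c′ ≤ 1 ≤ c and log(c) ≥ l(n+1)·log(q) − ((n−1)(n+1)²/4)·log(c′). Let k₀, k₁, …, k_n be integers with k₀ + ⋯ + k_n = 0 such that q^{k_{i+1} − k_i} ≥ c′ for every i with 0 ≤ i ≤ n−1, and such that q^{k_{i₀+1} − k_{i₀}} > c for at least one index i₀ with 0 ≤ i₀ ≤ n−1. Then for every i with 0 ≤ i ≤ n−1 one has −(k₀ + k₁ + ⋯ + k_i) ≥ l. -/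
open Finset in
/-- Summation by parts for the weights `j + 1`. -/
theorem sum_range_succ_mul_sub (f : ℕ → ℝ) (p : ℕ) :
    ∑ j ∈ range p, ((j : ℝ) + 1) * (f (j + 1) - f j) = p * f p - ∑ j ∈ range p, f j := by
  induction p with
  | zero => simp
  | succ p ih =>
    rw [sum_range_succ, ih, sum_range_succ]
    push_cast
    ring

open Finset in
/-- Summation by parts for the weights `m - j`. -/
theorem sum_range_sub_mul_sub (f : ℕ → ℝ) (m : ℕ) :
    ∑ j ∈ range m, ((m : ℝ) - j) * (f (j + 1) - f j) =
      ∑ j ∈ range (m + 1), f j - (m + 1) * f 0 := by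
  have h : ∑ j ∈ range m, ((m : ℝ) - j) * (f (j + 1) - f j) =
      (m + 1) * ∑ j ∈ range m, (f (j + 1) - f j) -
        ∑ j ∈ range m, ((j : ℝ) + 1) * (f (j + 1) - f j) := by
    rw [mul_sum, ← sum_sub_distrib]
    exact sum_congr rfl fun j _ => by ring
  rw [h, sum_range_sub, sum_range_succ_mul_sub, sum_range_succ]
  ring

/-- `n + 1` times the entry at `(i, j)` of the inverse of the Cartan matrix of type `A_n`, with
rows and columns indexed from `0`. -/
noncomputable def cartanInvWeight (n i j : ℕ) : ℝ :=
  if j < i then ((j : ℝ) + 1) * (n - i) else ((i : ℝ) + 1) * (n - j)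

theorem one_le_cartanInvWeight {n i j : ℕ} (hi : i < n) (hj : j < n) :
    1 ≤ cartanInvWeight n i j := by
  have hi' : (i : ℝ) + 1 ≤ n := by exact_mod_cast hi
  have hj' : (j : ℝ) + 1 ≤ n := by exact_mod_cast hj
  have hi₀ : (0 : ℝ) ≤ i := i.cast_nonneg
  have hj₀ : (0 : ℝ) ≤ j := j.cast_nonneg
  unfold cartanInvWeight
  split_ifs <;> nlinarith

theorem cartanInvWeight_le {n i j : ℕ} (hi : i < n) :
    cartanInvWeight n i j ≤ ((n : ℝ) + 1) ^ 2 / 4 := by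
  have hi' : (i : ℝ) + 1 ≤ n := by exact_mod_cast hi
  have hi₀ : (0 : ℝ) ≤ i := i.cast_nonneg
  have hmax : ((i : ℝ) + 1) * (n - i) ≤ ((n : ℝ) + 1) ^ 2 / 4 := by
    nlinarith [sq_nonneg ((n : ℝ) - 2 * i - 1)]
  refine le_trans ?_ hmax
  unfold cartanInvWeight
  split_ifs with h
  · have h' : (j : ℝ) ≤ i := by exact_mod_cast h.le
    exact mul_le_mul_of_nonneg_right (by linarith) (by linarith)
  · have h' : (i : ℝ) ≤ j := by exact_mod_cast not_lt.mp h
    exact mul_le_mul_of_nonneg_left (by linarith) (by linarith)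

open Finset in
/-- Partial sums expressed through consecutive differences. -/
theorem sum_cartanInvWeight_mul_sub (f : ℕ → ℝ) {n i : ℕ} (hi : i < n) :
    ∑ j ∈ range n, cartanInvWeight n i j * (f (j + 1) - f j) =
      (i + 1) * ∑ j ∈ range (n + 1), f j - (n + 1) * ∑ j ∈ range (i + 1), f j := by
  obtain ⟨m, rfl⟩ := Nat.exists_eq_add_of_le hi.le
  have hleft : ∑ j ∈ range i, cartanInvWeight (i + m) i j * (f (j + 1) - f j) =
      m * ∑ j ∈ range i, ((j : ℝ) + 1) * (f (j + 1) - f j) := by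
    rw [mul_sum]
    refine sum_congr rfl fun j hj => ?_
    rw [cartanInvWeight, if_pos (mem_range.mp hj)]
    push_cast
    ring
  have hright : ∑ j ∈ range m, cartanInvWeight (i + m) i (i + j) *
        (f (i + j + 1) - f (i + j)) =
      (i + 1) * ∑ j ∈ range m, ((m : ℝ) - j) * (f (i + (j + 1)) - f (i + j)) := by
    rw [mul_sum]
    refine sum_congr rfl fun j _ => ?_
    rw [cartanInvWeight, if_neg (by omega), ← add_assoc]
    push_cast
    ring
  rw [sum_range_add, hleft, hright, sum_range_succ_mul_sub,
    sum_range_sub_mul_sub fun j => f (i + j), add_assoc i m 1, sum_range_add f i (m + 1),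
    sum_range_succ f i]
  push_cast
  simp only [add_zero]
  ring

open Finset in
/-- A lower bound for a weighted sum with bounded weights, all of whose terms are bounded below
and one of which is large. -/
theorem add_mul_le_sum_weight_mul {n j₀ : ℕ} (hj₀ : j₀ < n) {w x : ℕ → ℝ} {W a b : ℝ}
    (hw₁ : ∀ j < n, 1 ≤ w j) (hwW : ∀ j < n, w j ≤ W) (ha : a ≤ 0) (hb : 0 ≤ b)
    (hx : ∀ j < n, a ≤ x j) (hxb : b ≤ x j₀) :
    b + ((n : ℝ) - 1) * W * a ≤ ∑ j ∈ range n, w j * x j := by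
  have hmem : j₀ ∈ range n := mem_range.mpr hj₀
  rw [← add_sum_erase _ _ hmem]
  refine add_le_add (by nlinarith [hw₁ j₀ hj₀]) ?_
  have h : #((range n).erase j₀) • (W * a) ≤ ∑ j ∈ (range n).erase j₀, w j * x j := by
    refine card_nsmul_le_sum _ _ _ fun j hj => ?_
    have hj : j < n := mem_range.mp (mem_of_mem_erase hj)
    nlinarith [hw₁ j hj, hwW j hj, hx j hj]
  rw [card_erase_of_mem hmem, card_range, nsmul_eq_mul,
    Nat.cast_sub (by omega : 1 ≤ n), Nat.cast_one] at h
  linarith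


/-- Lemma 4.4.2: if the integers `k₀, …, k_n` sum to `0`, satisfy `q^(k_{i+1}−k_i) ≥ c'` for
all `i < n` and `q^(k_{i₀+1}−k_{i₀}) > c` for some `i₀ < n`, where `0 < c' ≤ 1 ≤ c` and
`log c ≥ l(n+1)·log q − ((n−1)(n+1)²/4)·log c'`, then all the partial sums satisfy
`−(k₀ + ⋯ + k_i) ≥ l`. -/
theorem stmt_5 (n : ℕ) (hn : 1 ≤ n) (q : ℝ) (hq : 2 ≤ q) (l : ℕ) (hl : 1 ≤ l)
    (c' c : ℝ) (hc'0 : 0 < c') (hc'1 : c' ≤ 1) (hc1 : 1 ≤ c)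
    (hlog : Real.log c ≥
      (l : ℝ) * ((n : ℝ) + 1) * Real.log q -
        (((n : ℝ) - 1) * ((n : ℝ) + 1) ^ 2 / 4) * Real.log c')
    (k : ℕ → ℤ) (hsum : ∑ j ∈ Finset.range (n + 1), k j = 0)
    (hlow : ∀ i < n, c' ≤ q ^ (k (i + 1) - k i))
    (hbig : ∃ i₀ < n, c < q ^ (k (i₀ + 1) - k i₀)) :
    ∀ i < n, (l : ℤ) ≤ -∑ j ∈ Finset.range (i + 1), k j := by
  intro i hi
  obtain ⟨i₀, hi₀, hbig⟩ := hbig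
  have hq₀ : 0 < q := by linarith
  have hlogq : 0 < Real.log q := Real.log_pos (by linarith)
  have hlow' : ∀ j < n, Real.log c' ≤ Real.log q * k (j + 1) - Real.log q * k j := by
    intro j hj
    have h := Real.log_le_log hc'0 (hlow j hj)
    rw [Real.log_zpow] at h
    push_cast at h
    linarith
  have hbig' : Real.log c ≤ Real.log q * k (i₀ + 1) - Real.log q * k i₀ := by
    have h := Real.log_le_log (by linarith) hbig.le
    rw [Real.log_zpow] at h
    push_cast at h
    linarith
  have hbound := add_mul_le_sum_weight_mul hi₀
    (x := fun j => Real.log q * k (j + 1) - Real.log q * k j)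
    (fun j hj => one_le_cartanInvWeight hi hj) (fun j _ => cartanInvWeight_le hi)
    (Real.log_nonpos hc'0.le hc'1) (Real.log_nonneg hc1) hlow' hbig'
  have hsum' : ∑ j ∈ Finset.range (n + 1), (k j : ℝ) = 0 := by exact_mod_cast hsum
  rw [sum_cartanInvWeight_mul_sub (fun j => Real.log q * k j) hi, ← Finset.mul_sum,
    ← Finset.mul_sum, hsum'] at hbound
  have hpos : 0 < ((n : ℝ) + 1) * Real.log q := by positivity
  have hreal : (l : ℝ) ≤ -∑ j ∈ Finset.range (i + 1), (k j : ℝ) :=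
    le_of_mul_le_mul_left (by linarith) hpos
  exact_mod_cast hreal
end
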